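/- Let 1 < ε₁ < ε₂ < ∞ and let f be a smooth function compactly supported in B_{ε₁,ε₂} ∩ U, where U = {x₃ > 0}, with polar form F. Let ε₁ ≤ ε ≤ ε₂ and δ = (ε²−1)/(2ε). If the apple interior transform 𝒜𝓘f(r,α,β) = ∫₀^{2π} ∫₀^π ∫₁^{√(r² sin²φ+1) + r sin φ} ρ² sin φ (h·F)(ρ,θ,φ) dρ dφ dθ vanishes for all r ∈ [0,δ], α ∈ [0,2π], β ∈ [0,π], then f(x) = 0 for all x with 1 ≤ |x| ≤ ε. -/

import Mathlib

noncomputable section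
open Real MeasureTheory Set

abbrev R3 := EuclideanSpace ℝ (Fin 3)

/-- The unit vector with spherical angles `θ` (azimuth) and `φ` (colatitude). -/
def sphVec (θ φ : ℝ) : R3 :=
  (WithLp.equiv 2 (Fin 3 → ℝ)).symm ![sin φ * cos θ, sin φ * sin θ, cos φ]

/-- Rotation about the `x₃` axis by angle `α`. -/
def rotZ (α : ℝ) (x : R3) : R3 :=
  (WithLp.equiv 2 (Fin 3 → ℝ)).symm
    ![cos α * x 0 - sin α * x 1, sin α * x 0 + cos α * x 1, x 2]

/-- Rotation about the `x₂` axis by angle `β`. -/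
def rotY (β : ℝ) (x : R3) : R3 :=
  (WithLp.equiv 2 (Fin 3 → ℝ)).symm
    ![cos β * x 0 + sin β * x 2, x 1, -sin β * x 0 + cos β * x 2]

/-- `h = U(α)V(β)`. -/
def rotUV (α β : ℝ) (x : R3) : R3 := rotZ α (rotY β x)

/-- The hollow ball `B_{a,b} = {x ∈ ℝ³ : a < |x| < b}`. -/
def hollowBall (a b : ℝ) : Set R3 := {x : R3 | a < ‖x‖ ∧ ‖x‖ < b}

/-- The open upper half space `U = {x₃ > 0}`. -/
def upperHalf : Set R3 := {x : R3 | 0 < x 2}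

/-- The apple interior transform `𝒜𝓘f`. -/
def appleIntT (f : R3 → ℝ) (r α β : ℝ) : ℝ :=
  ∫ θ in (0:ℝ)..(2 * π), ∫ φ in (0:ℝ)..π,
    ∫ ρ in (1:ℝ)..(Real.sqrt (r ^ 2 * sin φ ^ 2 + 1) + r * sin φ),
      ρ ^ 2 * sin φ * f (ρ • rotUV α β (sphVec θ φ))

open scoped ENNReal Pointwise

/-- The unit sphere of `ℝ³`. -/
abbrev S2 := Metric.sphere (0 : R3) 1

/-- The surface measure on the unit sphere of `ℝ³`. -/
def surf : Measure S2 := (volume : Measure R3).toSphere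

@[simp] lemma sphVec_zero (θ φ : ℝ) : sphVec θ φ 0 = sin φ * cos θ := rfl
@[simp] lemma sphVec_one (θ φ : ℝ) : sphVec θ φ 1 = sin φ * sin θ := rfl
@[simp] lemma sphVec_two (θ φ : ℝ) : sphVec θ φ 2 = cos φ := rfl

lemma norm_sq_eq_coords (x : R3) : ‖x‖ ^ 2 = x 0 ^ 2 + x 1 ^ 2 + x 2 ^ 2 := by
  rw [EuclideanSpace.norm_sq_eq, Fin.sum_univ_three]
  simp

lemma inner_eq_coords (x y : R3) : inner ℝ x y = x 0 * y 0 + x 1 * y 1 + x 2 * y 2 := by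
  simp only [PiLp.inner_apply, Fin.sum_univ_three, RCLike.inner_apply, conj_trivial]
  ring

lemma norm_sphVec (θ φ : ℝ) : ‖sphVec θ φ‖ = 1 := by
  have h := norm_sq_eq_coords (sphVec θ φ)
  have h2 : ‖sphVec θ φ‖ ^ 2 = 1 := by
    rw [h]
    simp only [sphVec_zero, sphVec_one, sphVec_two]
    nlinarith [sin_sq_add_cos_sq θ, sin_sq_add_cos_sq φ]
  exact (pow_eq_one_iff_of_nonneg (norm_nonneg _) two_ne_zero).1 h2

lemma continuous_of_coords {X : Type*} [TopologicalSpace X] {g : X → R3}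
    (h : ∀ i, Continuous fun x => g x i) : Continuous g :=
  (PiLp.continuous_toLp 2 _).comp (continuous_pi h)

lemma continuous_sphVec : Continuous fun p : ℝ × ℝ => sphVec p.1 p.2 := by
  refine continuous_of_coords fun i => ?_
  fin_cases i <;> simp <;> fun_prop

/-- `sphVec` as a map into the sphere. -/
def sphPt (p : ℝ × ℝ) : S2 := ⟨sphVec p.1 p.2, by simp [norm_sphVec]⟩

lemma continuous_sphPt : Continuous sphPt := continuous_sphVec.subtype_mk _

/-- The point with cylindrical coordinates `z`, `q`, `θ`. -/
def cylVec (z q θ : ℝ) : R3 := !₂[q * cos θ, q * sin θ, z]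

lemma continuous_cylVec : Continuous fun p : ℝ × ℝ × ℝ => cylVec p.1 p.2.1 p.2.2 := by
  refine continuous_of_coords fun i => ?_
  fin_cases i <;> simp [cylVec] <;> fun_prop

lemma cylVec_polar (ρ θ φ : ℝ) : cylVec (ρ * cos φ) (ρ * sin φ) θ = ρ • sphVec θ φ := by
  ext i
  fin_cases i <;> simp [cylVec] <;> ring

lemma lintegral_R3_eq_prod (H : R3 → ℝ≥0∞) (hH : Measurable H) :
    ∫⁻ x, H x = ∫⁻ p : ℝ × (ℝ × ℝ), H !₂[p.2.1, p.2.2, p.1] := by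
  have e1 := PiLp.volume_preserving_toLp (Fin 3)
  have e2 := (volume_preserving_piFinSuccAbove (fun _ : Fin 3 => ℝ) 2).symm
  have e3 : MeasurePreserving
      (fun p : ℝ × (ℝ × ℝ) => (p.1, (MeasurableEquiv.finTwoArrow (α := ℝ)).symm p.2)) :=
    (MeasurePreserving.id volume).prod (volume_preserving_finTwoArrow ℝ).symm
  have e := e1.comp (e2.comp e3)
  rw [← e.lintegral_comp hH]
  refine lintegral_congr fun p => ?_
  congr 1
  ext i
  fin_cases i <;> rfl

lemma lintegral_R3_cyl (H : R3 → ℝ≥0∞) (hH : Measurable H) :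
    ∫⁻ x, H x = ∫⁻ z, ∫⁻ q in Ioi (0:ℝ), ENNReal.ofReal q *
      ∫⁻ θ in Ioo (-π) π, H (cylVec z q θ) := by
  have hm : Measurable fun p : ℝ × (ℝ × ℝ) => (!₂[p.2.1, p.2.2, p.1] : R3) := by
    refine Continuous.measurable (continuous_of_coords fun i => ?_)
    fin_cases i <;> simp <;> fun_prop
  rw [lintegral_R3_eq_prod H hH, Measure.volume_eq_prod,
    lintegral_prod (fun p : ℝ × (ℝ × ℝ) => H !₂[p.2.1, p.2.2, p.1]) (hH.comp hm).aemeasurable]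
  refine lintegral_congr fun z => ?_
  rw [← lintegral_comp_polarCoord_symm, polarCoord_target, Measure.volume_eq_prod,
    ← Measure.prod_restrict, lintegral_prod]
  · refine lintegral_congr fun q => ?_
    rw [← lintegral_const_mul]
    · simp [polarCoord_symm_apply, cylVec]
    · exact hH.comp (continuous_cylVec.measurable.comp
        (by fun_prop : Measurable fun θ : ℝ => (z, q, θ)))
  · refine Measurable.aemeasurable ?_
    simp only [polarCoord_symm_apply, smul_eq_mul]
    refine Measurable.mul (by fun_prop) (hH.comp ?_)
    exact hm.comp (by fun_prop : Measurable fun p : ℝ × ℝ => (z, (p.1 * cos p.2, p.1 * sin p.2)))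

lemma lintegral_R3_spherical (H : R3 → ℝ≥0∞) (hH : Measurable H) :
    ∫⁻ x, H x = ∫⁻ ρ in Ioi (0:ℝ), ∫⁻ φ in Ioo 0 π, ENNReal.ofReal (ρ ^ 2 * sin φ) *
      ∫⁻ θ in Ioo (-π) π, H (ρ • sphVec θ φ) := by
  set K : ℝ × ℝ → ℝ≥0∞ := fun p => ∫⁻ θ in Ioo (-π) π, H (cylVec p.1 p.2 θ) with hK
  have hKm : Measurable K := by
    refine Measurable.lintegral_prod_right'
      (f := fun p : (ℝ × ℝ) × ℝ => H (cylVec p.1.1 p.1.2 p.2)) ?_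
    exact hH.comp (continuous_cylVec.measurable.comp
      (by fun_prop : Measurable fun p : (ℝ × ℝ) × ℝ => (p.1.1, p.1.2, p.2)))
  set M : ℝ × ℝ → ℝ≥0∞ := fun p =>
    (Ioi (0:ℝ)).indicator (fun q => ENNReal.ofReal q * K (p.1, q)) p.2
    with hM
  have hMm : Measurable M := by
    have : M = {p : ℝ × ℝ | 0 < p.2}.indicator (fun p => ENNReal.ofReal p.2 * K p) := by
      ext p; simp [hM, indicator]
    rw [this]
    have hs : MeasurableSet {p : ℝ × ℝ | 0 < p.2} :=
      measurableSet_lt measurable_const measurable_snd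
    exact Measurable.indicator ((measurable_snd.ennreal_ofReal).mul hKm) hs
  have h1 : ∫⁻ x, H x = ∫⁻ p, M p := by
    rw [lintegral_R3_cyl H hH, Measure.volume_eq_prod, lintegral_prod _ hMm.aemeasurable]
    refine lintegral_congr fun z => ?_
    rw [← lintegral_indicator (measurableSet_Ioi (a := (0:ℝ)))]
  have hpc : Measurable fun p : ℝ × ℝ => (p.1 * cos p.2, p.1 * sin p.2) := by fun_prop
  rw [h1, ← lintegral_comp_polarCoord_symm, polarCoord_target, Measure.volume_eq_prod,
    ← Measure.prod_restrict, lintegral_prod]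
  · refine setLIntegral_congr_fun measurableSet_Ioi fun ρ hρ => ?_
    have hρ : 0 < ρ := hρ
    have hsub : Ioo 0 π ⊆ Ioo (-π) π := Ioo_subset_Ioo (by linarith [pi_pos]) le_rfl
    dsimp only
    rw [← inter_eq_self_of_subset_left hsub, ← Measure.restrict_restrict measurableSet_Ioo,
      ← lintegral_indicator (s := Ioo 0 π) measurableSet_Ioo]
    refine setLIntegral_congr_fun measurableSet_Ioo fun φ hφ => ?_
    simp only [polarCoord_symm_apply, hM, smul_eq_mul]
    by_cases h0 : 0 < φ
    · have hs : 0 < sin φ := sin_pos_of_pos_of_lt_pi h0 hφ.2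
      rw [indicator_of_mem (show ρ * sin φ ∈ Ioi 0 from mul_pos hρ hs),
        indicator_of_mem (show φ ∈ Ioo 0 π from ⟨h0, hφ.2⟩), ← mul_assoc,
        ← ENNReal.ofReal_mul hρ.le]
      simp only [hK, cylVec_polar]
      congr 2
      ring
    · have hs : sin φ ≤ 0 := sin_nonpos_of_nonpos_of_neg_pi_le (not_lt.1 h0) hφ.1.le
      rw [indicator_of_notMem (show ρ * sin φ ∉ Ioi 0 from
        not_lt.2 (mul_nonpos_of_nonneg_of_nonpos hρ.le hs)),
        indicator_of_notMem (fun h => h0 h.1), mul_zero]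
  · refine Measurable.aemeasurable ?_
    simp only [polarCoord_symm_apply, smul_eq_mul]
    exact Measurable.mul (by fun_prop) (hMm.comp hpc)

lemma cone_preimage_eq (A : Set R3) :
    Ioo (0:ℝ) 1 • ((↑) '' ((↑) ⁻¹' A : Set S2) : Set R3) =
      {x : R3 | 0 < ‖x‖ ∧ ‖x‖ < 1} ∩ (fun x : R3 => ‖x‖⁻¹ • x) ⁻¹' A := by
  ext x
  simp only [Set.mem_smul, mem_image, mem_preimage, mem_inter_iff, mem_ofPred_eq]
  constructor
  · rintro ⟨ρ, hρ, _, ⟨y, hy, rfl⟩, rfl⟩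
    have hn : ‖ρ • (y : R3)‖ = ρ := by
      rw [norm_smul, norm_eq_of_mem_sphere, mul_one, Real.norm_of_nonneg hρ.1.le]
    rw [hn, inv_smul_smul₀ hρ.1.ne']
    exact ⟨hρ, hy⟩
  · rintro ⟨hx, hA⟩
    refine ⟨‖x‖, hx, ‖x‖⁻¹ • x, ⟨⟨‖x‖⁻¹ • x, ?_⟩, hA, rfl⟩, smul_inv_smul₀ hx.1.ne' x⟩
    simp [norm_smul, hx.1.ne']

/-- The measure `sin φ dφ dθ` on the parameter rectangle, with `φ` as first coordinate. -/
def sphParam : Measure (ℝ × ℝ) :=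
  ((volume.restrict (Ioo 0 π)).withDensity fun φ => ENNReal.ofReal (sin φ)).prod
    (volume.restrict (Ioo (-π) π))

lemma lintegral_sq_unit : ∫⁻ ρ in Ioo (0:ℝ) 1, ENNReal.ofReal (ρ ^ 2) = ENNReal.ofReal (1 / 3) := by
  rw [← ofReal_integral_eq_lintegral_ofReal, ← integral_Ioc_eq_integral_Ioo,
    ← intervalIntegral.integral_of_le zero_le_one, integral_pow]
  · norm_num
  · exact ((continuous_pow 2).integrableOn_Icc (a := (0:ℝ)) (b := 1)).mono_set Ioo_subset_Icc_self
  · exact Filter.Eventually.of_forall fun ρ => sq_nonneg ρ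

lemma surf_eq_map : surf = sphParam.map fun p => sphPt (p.2, p.1) := by
  have hpar : Measurable fun p : ℝ × ℝ => sphPt (p.2, p.1) :=
    (continuous_sphPt.comp continuous_swap).measurable
  ext A hA
  obtain ⟨A, hA, rfl⟩ := hA
  rw [Measure.map_apply hpar (measurable_subtype_coe hA), surf,
    Measure.toSphere_apply' _ (measurable_subtype_coe hA), cone_preimage_eq, finrank_euclideanSpace,
    Fintype.card_fin]
  set C := {x : R3 | 0 < ‖x‖ ∧ ‖x‖ < 1} ∩ (fun x : R3 => ‖x‖⁻¹ • x) ⁻¹' A with hC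
  have hCm : MeasurableSet C := by
    refine MeasurableSet.inter ?_ ((by fun_prop : Measurable fun x : R3 => ‖x‖⁻¹ • x) hA)
    exact (measurableSet_lt measurable_const measurable_norm).inter
      (measurableSet_lt measurable_norm measurable_const)
  set W : ℝ → ℝ≥0∞ := fun φ => ∫⁻ θ in Ioo (-π) π, A.indicator 1 (sphVec θ φ) with hW
  have hAi : Measurable (A.indicator (1 : R3 → ℝ≥0∞)) := measurable_one.indicator hA
  have hWm : Measurable W := by
    refine Measurable.lintegral_prod_right'
      (f := fun p : ℝ × ℝ => A.indicator 1 (sphVec p.2 p.1)) ?_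
    exact hAi.comp (continuous_sphVec.comp continuous_swap).measurable
  have hR : sphParam ((fun p : ℝ × ℝ => sphPt (p.2, p.1)) ⁻¹' ((↑) ⁻¹' A)) =
      ∫⁻ φ in Ioo 0 π, ENNReal.ofReal (sin φ) * W φ := by
    rw [← lintegral_indicator_one (hpar (measurable_subtype_coe hA)), sphParam, lintegral_prod,
      lintegral_withDensity_eq_lintegral_mul]
    · rfl
    · fun_prop
    · exact hWm
    · exact (measurable_one.indicator (hpar (measurable_subtype_coe hA))).aemeasurable
  have hL : volume C = ENNReal.ofReal (1 / 3) * ∫⁻ φ in Ioo 0 π, ENNReal.ofReal (sin φ) * W φ := by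
    rw [← lintegral_indicator_one hCm, lintegral_R3_spherical _ (measurable_one.indicator hCm),
      ← lintegral_sq_unit, ← lintegral_mul_const _ (by fun_prop)]
    rw [← inter_eq_self_of_subset_left (Ioo_subset_Ioi_self : Ioo (0:ℝ) 1 ⊆ Ioi 0),
      ← Measure.restrict_restrict measurableSet_Ioo,
      ← lintegral_indicator (s := Ioo (0:ℝ) 1) measurableSet_Ioo]
    refine setLIntegral_congr_fun measurableSet_Ioi fun ρ hρ => ?_
    have hρ : 0 < ρ := hρ
    have hn : ∀ θ φ, ‖ρ • sphVec θ φ‖ = ρ := fun θ φ => by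
      rw [norm_smul, norm_sphVec, mul_one, Real.norm_of_nonneg hρ.le]
    by_cases h1 : ρ < 1
    · rw [indicator_of_mem (show ρ ∈ Ioo (0:ℝ) 1 from ⟨hρ, h1⟩),
        ← lintegral_const_mul _ (by fun_prop)]
      refine lintegral_congr fun φ => ?_
      rw [ENNReal.ofReal_mul (sq_nonneg ρ), mul_assoc]
      congr 2
      refine lintegral_congr fun θ => ?_
      have : ρ • sphVec θ φ ∈ C ↔ sphVec θ φ ∈ A := by
        rw [hC, mem_inter_iff, mem_ofPred_eq, hn, mem_preimage, hn, inv_smul_smul₀ hρ.ne']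
        exact ⟨And.right, fun h => ⟨⟨hρ, h1⟩, h⟩⟩
      by_cases hm : sphVec θ φ ∈ A
      · rw [indicator_of_mem (this.2 hm), indicator_of_mem hm]; rfl
      · rw [indicator_of_notMem (fun h => hm (this.1 h)), indicator_of_notMem hm]
    · rw [indicator_of_notMem (fun h => h1 h.2)]
      refine (lintegral_congr fun φ => ?_).trans lintegral_zero
      have : ∀ θ, C.indicator (1 : R3 → ℝ≥0∞) (ρ • sphVec θ φ) = 0 := fun θ =>
        indicator_of_notMem (fun h => h1 (by simpa [hn] using h.1.2)) _
      simp [this]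
  rw [hR, hL, ← mul_assoc, show ((3 : ℕ) : ℝ≥0∞) = ENNReal.ofReal 3 by norm_num,
    ← ENNReal.ofReal_mul (by norm_num)]
  norm_num

instance : IsFiniteMeasure surf := by unfold surf; infer_instance

lemma integrable_surf {F : S2 → ℝ} (hF : Continuous F) : Integrable F surf :=
  hF.integrable_of_hasCompactSupport (HasCompactSupport.of_compactSpace F)

lemma integral_surf {F : R3 → ℝ} (hF : Continuous F) :
    ∫ y : S2, F y ∂surf = ∫ φ in (0:ℝ)..π, sin φ * ∫ θ in (0:ℝ)..(2 * π), F (sphVec θ φ) := by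
  have hpar : Measurable fun p : ℝ × ℝ => sphPt (p.2, p.1) :=
    (continuous_sphPt.comp continuous_swap).measurable
  have hi : Integrable (fun y : S2 => F y) surf := integrable_surf (hF.comp continuous_subtype_val)
  rw [surf_eq_map] at hi ⊢
  rw [integral_map hpar.aemeasurable hi.aestronglyMeasurable]
  have hi' := hi.comp_measurable hpar
  rw [sphParam] at hi' ⊢
  rw [integral_prod (fun p : ℝ × ℝ => F (sphPt (p.2, p.1))) hi',
    integral_withDensity_eq_integral_toReal_smul (by fun_prop)
    (Filter.Eventually.of_forall fun _ => ENNReal.ofReal_lt_top),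
    intervalIntegral.integral_of_le pi_pos.le, integral_Ioc_eq_integral_Ioo]
  refine setIntegral_congr_fun measurableSet_Ioo fun φ hφ => ?_
  have hs : 0 ≤ sin φ := (sin_pos_of_pos_of_lt_pi hφ.1 hφ.2).le
  have hper : Function.Periodic (fun θ => F (sphVec θ φ)) (2 * π) := fun θ => by simp [sphVec]
  have hp := hper.intervalIntegral_add_eq 0 (-π)
  rw [zero_add, show -π + 2 * π = π by ring] at hp
  simp only [ENNReal.toReal_ofReal hs, smul_eq_mul]
  rw [hp, intervalIntegral.integral_of_le (by linarith [pi_pos]), integral_Ioc_eq_integral_Ioo]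
  rfl

lemma integral_surf' {F : R3 → ℝ} (hF : Continuous F) :
    ∫ y : S2, F y ∂surf = ∫ θ in (0:ℝ)..(2 * π), ∫ φ in (0:ℝ)..π, sin φ * F (sphVec θ φ) := by
  rw [integral_surf hF, intervalIntegral_intervalIntegral_swap]
  · simp_rw [intervalIntegral.integral_const_mul]
  · have hc : Continuous (Function.uncurry fun θ φ => sin φ * F (sphVec θ φ)) :=
      (continuous_sin.comp continuous_snd).mul (hF.comp continuous_sphVec)
    have := (hc.integrableOn_Icc (μ := volume.prod volume) (a := ((0:ℝ), (0:ℝ))) (b := (2 * π, π)))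
    rw [← Icc_prod_Icc] at this
    rw [uIoc_of_le (by positivity), uIoc_of_le pi_pos.le]
    exact this.mono_set (prod_mono Ioc_subset_Icc_self Ioc_subset_Icc_self)

lemma integral_surf_comp_isometry (L : R3 ≃ₗᵢ[ℝ] R3) (F : R3 → ℝ) :
    ∫ y : S2, F (L y) ∂surf = ∫ y : S2, F y ∂surf := by
  set e : S2 → S2 := fun y => ⟨L y, by simp [L.norm_map]⟩ with he
  have hem : Measurable e := (L.continuous.comp continuous_subtype_val).subtype_mk _ |>.measurable
  have hmp : surf.map e = surf := by
    ext A hA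
    obtain ⟨A, hA, rfl⟩ := hA
    have h1 : e ⁻¹' ((↑) ⁻¹' A) = (↑) ⁻¹' (L ⁻¹' A) := rfl
    rw [Measure.map_apply hem (measurable_subtype_coe hA), h1, surf,
      Measure.toSphere_apply' _ (measurable_subtype_coe hA),
      Measure.toSphere_apply' _ (measurable_subtype_coe (L.continuous.measurable hA)),
      cone_preimage_eq, cone_preimage_eq]
    congr 1
    refine (congrArg _ ?_).trans
      (L.measurePreserving.measure_preimage_emb L.toHomeomorph.measurableEmbedding _)
    ext x
    simp
  have hemb : MeasurableEmbedding e := by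
    refine MeasurableEquiv.measurableEmbedding (⟨⟨e, fun y => ⟨L.symm y, by simp⟩,
      fun y => by simp [he], fun y => by simp [he]⟩, hem, ?_⟩ : S2 ≃ᵐ S2)
    exact (L.symm.continuous.comp continuous_subtype_val).subtype_mk _ |>.measurable
  conv_rhs => rw [← hmp, hemb.integral_map]

lemma norm_rotUV (α β : ℝ) (x : R3) : ‖rotUV α β x‖ = ‖x‖ := by
  rw [← sq_eq_sq₀ (norm_nonneg _) (norm_nonneg _), norm_sq_eq_coords, norm_sq_eq_coords]
  simp only [rotUV, rotZ, rotY, WithLp.equiv_symm_apply, Matrix.cons_val]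
  linear_combination ((cos β * x 0 + sin β * x 2) ^ 2 + x 1 ^ 2) * sin_sq_add_cos_sq α +
    (x 0 ^ 2 + x 2 ^ 2) * sin_sq_add_cos_sq β

/-- `rotUV α β` as a linear isometry of `ℝ³`. -/
def rotIso (α β : ℝ) : R3 ≃ₗᵢ[ℝ] R3 :=
  LinearIsometry.toLinearIsometryEquiv
    ⟨{ toFun := rotUV α β
       map_add' := fun x y => by
        ext i
        fin_cases i <;> simp [rotUV, rotZ, rotY] <;> ring
       map_smul' := fun c x => by
        ext i
        fin_cases i <;> simp [rotUV, rotZ, rotY] <;> ring }, norm_rotUV α β⟩ rfl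

@[simp] lemma rotIso_apply (α β : ℝ) (x : R3) : rotIso α β x = rotUV α β x := rfl

lemma inner_sphVec_rotUV (α β : ℝ) (x : R3) : inner ℝ (sphVec α β) (rotUV α β x) = x 2 := by
  rw [inner_eq_coords]
  simp only [sphVec_zero, sphVec_one, sphVec_two, rotUV, rotZ, rotY, WithLp.equiv_symm_apply,
    Matrix.cons_val]
  linear_combination (sin β * (cos β * x 0 + sin β * x 2)) * sin_sq_add_cos_sq α +
    x 2 * sin_sq_add_cos_sq β

lemma exists_sphVec_eq (y : R3) (hy : ‖y‖ = 1) :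
    ∃ α ∈ Icc 0 (2 * π), ∃ β ∈ Icc 0 π, sphVec α β = y := by
  have h := norm_sq_eq_coords y
  rw [hy] at h
  have hs : √(1 - y 2 ^ 2) = ‖(⟨y 0, y 1⟩ : ℂ)‖ := by
    rw [Complex.norm_def, Complex.normSq_mk]
    congr 1
    linarith
  have hc : cos (arccos (y 2)) = y 2 :=
    cos_arccos (by nlinarith [sq_nonneg (y 0), sq_nonneg (y 1)])
      (by nlinarith [sq_nonneg (y 0), sq_nonneg (y 1)])
  refine ⟨toIcoMod two_pi_pos 0 (Complex.arg ⟨y 0, y 1⟩), ?_, arccos (y 2),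
    ⟨arccos_nonneg _, arccos_le_pi _⟩, ?_⟩
  · have := toIcoMod_mem_Ico two_pi_pos 0 (Complex.arg ⟨y 0, y 1⟩)
    rw [zero_add] at this
    exact Ico_subset_Icc_self this
  · have hper : ∀ x : ℝ, ∃ n : ℤ, toIcoMod two_pi_pos 0 x = x - n * (2 * π) := fun x =>
      ⟨toIcoDiv two_pi_pos 0 x, by rw [← zsmul_eq_mul]; rfl⟩
    obtain ⟨n, hn⟩ := hper (Complex.arg ⟨y 0, y 1⟩)
    ext i
    fin_cases i
    · simp [sin_arccos, hs, hn, cos_sub_int_mul_two_pi]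
    · simp [sin_arccos, hs, hn, sin_sub_int_mul_two_pi]
    · simpa using hc

/-- The integral of `ρ² f(ρ y)` over `1 ≤ ρ ≤ √(t² + 1) + t`. -/
def radialInt (f : R3 → ℝ) (y : R3) (t : ℝ) : ℝ :=
  ∫ ρ in (1:ℝ)..(√(t ^ 2 + 1) + t), ρ ^ 2 * f (ρ • y)

lemma continuous_radialInt {f : R3 → ℝ} (hf : Continuous f) :
    Continuous fun p : R3 × ℝ => radialInt f p.1 p.2 := by
  unfold radialInt
  refine intervalIntegral.continuous_parametric_intervalIntegral_of_continuous
    (f := fun (p : R3 × ℝ) ρ => ρ ^ 2 * f (ρ • p.1)) ?_ (by fun_prop)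
  simp only [Function.uncurry_def]
  fun_prop

lemma sqrt_one_sub_cos_sq {φ : ℝ} (hφ : φ ∈ Icc 0 π) : √(1 - cos φ ^ 2) = sin φ := by
  rw [← sin_sq, sqrt_sq (sin_nonneg_of_nonneg_of_le_pi hφ.1 hφ.2)]

lemma appleIntT_eq_integral_surf {f : R3 → ℝ} (hf : Continuous f) (r α β : ℝ) :
    appleIntT f r α β =
      ∫ y : S2, radialInt f y (r * √(1 - inner ℝ (sphVec α β) (y : R3) ^ 2)) ∂surf := by
  have hG := continuous_radialInt hf
  rw [← integral_surf_comp_isometry (rotIso α β)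
    (fun y => radialInt f y (r * √(1 - inner ℝ (sphVec α β) (y : R3) ^ 2)))]
  simp only [rotIso_apply, inner_sphVec_rotUV]
  have hc : Continuous fun x : R3 => radialInt f (rotUV α β x) (r * √(1 - x 2 ^ 2)) := by
    have h1 : Continuous (rotUV α β) := (rotIso α β).continuous
    exact hG.comp (h1.prodMk (by fun_prop))
  rw [integral_surf' hc, appleIntT]
  refine intervalIntegral.integral_congr fun θ _ => intervalIntegral.integral_congr fun φ hφ => ?_
  rw [uIcc_of_le pi_pos.le] at hφ
  simp only [sphVec_two, sqrt_one_sub_cos_sq hφ, radialInt]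
  rw [← intervalIntegral.integral_const_mul, mul_pow]
  refine intervalIntegral.integral_congr fun ρ _ => ?_
  ring

/-- The integral of `cos ^ j` over a period. -/
def cosMoment (j : ℕ) : ℝ := ∫ θ in (0:ℝ)..(2 * π), cos θ ^ j

lemma cosMoment_odd (k : ℕ) : cosMoment (2 * k + 1) = 0 := by
  have hper : Function.Periodic (fun θ => cos θ ^ (2 * k + 1)) (2 * π) := fun θ => by simp
  have h := hper.intervalIntegral_add_eq 0 π
  rw [zero_add, show π + 2 * π = 2 * π + π by ring] at h
  have h2 := intervalIntegral.integral_comp_add_right (a := 0) (b := 2 * π)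
    (fun θ => cos θ ^ (2 * k + 1)) π
  rw [zero_add, ← h] at h2
  simp only [cos_add_pi, Odd.neg_pow (⟨k, rfl⟩ : Odd (2 * k + 1)),
    intervalIntegral.integral_neg] at h2
  unfold cosMoment
  linarith

lemma cosMoment_even_pos (k : ℕ) : 0 < cosMoment (2 * k) := by
  refine intervalIntegral.integral_pos two_pi_pos (by fun_prop) (fun θ _ => ?_)
    ⟨0, ⟨le_rfl, two_pi_pos.le⟩, by simp⟩
  rw [pow_mul]
  positivity

lemma sum_range_of_odd_eq_zero (g : ℕ → ℝ) (hg : ∀ k, g (2 * k + 1) = 0) (m : ℕ) :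
    ∑ j ∈ Finset.range (2 * m + 1), g j = ∑ k ∈ Finset.range (m + 1), g (2 * k) := by
  induction m with
  | zero => simp
  | succ m ih =>
    rw [show 2 * (m + 1) + 1 = 2 * m + 1 + 1 + 1 by ring, Finset.sum_range_succ,
      Finset.sum_range_succ, ih, hg, Finset.sum_range_succ _ (m + 1)]
    simp [mul_add]

/-- The mean of an even power of a linear functional along a circle of latitude, as a function of
the squared height `x` of the functional and the squared sine `u` of the colatitude. -/
def zonalMean (m : ℕ) (x u : ℝ) : ℝ :=
  ∑ k ∈ Finset.range (m + 1), ((2 * m).choose (2 * k) * cosMoment (2 * k)) *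
    (x ^ (m - k) * (1 - x) ^ k) * ((1 - u) ^ (m - k) * u ^ k)

lemma integral_affine_cos_pow (A B : ℝ) (m : ℕ) :
    ∫ θ in (0:ℝ)..(2 * π), (A * cos θ + B) ^ (2 * m) =
      ∑ k ∈ Finset.range (m + 1),
        ((2 * m).choose (2 * k) * cosMoment (2 * k)) * (A ^ 2) ^ k * (B ^ 2) ^ (m - k) := by
  simp_rw [add_pow]
  rw [intervalIntegral.integral_finsetSum
    fun j _ => (by fun_prop : Continuous _).intervalIntegrable _ _]
  have hj : ∀ j, ∫ θ in (0:ℝ)..(2 * π), (A * cos θ) ^ j * B ^ (2 * m - j) * ((2 * m).choose j) =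
      A ^ j * B ^ (2 * m - j) * ((2 * m).choose j) * cosMoment j := fun j => by
    rw [cosMoment, ← intervalIntegral.integral_const_mul]
    refine intervalIntegral.integral_congr fun θ _ => ?_
    simp only [mul_pow]
    ring
  simp_rw [hj]
  rw [sum_range_of_odd_eq_zero _ fun k => by rw [cosMoment_odd, mul_zero]]
  refine Finset.sum_congr rfl fun k _ => ?_
  rw [← pow_mul, ← pow_mul, Nat.mul_sub]
  ring

lemma integral_sphVec_pairing_pow (w : R3) (hw : ‖w‖ = 1) (φ : ℝ) (m : ℕ) :
    ∫ θ in (0:ℝ)..(2 * π), inner ℝ (sphVec θ φ) w ^ (2 * m) =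
      zonalMean m (w 2 ^ 2) (sin φ ^ 2) := by
  have hn := norm_sq_eq_coords w
  rw [hw] at hn
  set ζ : ℂ := ⟨w 0, w 1⟩ with hζ
  have h0 : ‖ζ‖ * cos ζ.arg = w 0 := Complex.norm_mul_cos_arg ζ
  have h1 : ‖ζ‖ * sin ζ.arg = w 1 := Complex.norm_mul_sin_arg ζ
  have hq : ‖ζ‖ ^ 2 = 1 - w 2 ^ 2 := by
    rw [Complex.sq_norm, hζ, Complex.normSq_mk]
    linarith
  have hper : Function.Periodic
      (fun θ => (sin φ * ‖ζ‖ * cos θ + cos φ * w 2) ^ (2 * m)) (2 * π) := fun θ => by simp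
  have hs := hper.intervalIntegral_add_eq 0 (-ζ.arg)
  rw [zero_add, show -ζ.arg + 2 * π = 2 * π - ζ.arg by ring, neg_eq_zero_sub,
    ← intervalIntegral.integral_comp_sub_right
      (fun θ => (sin φ * ‖ζ‖ * cos θ + cos φ * w 2) ^ (2 * m)),
    integral_affine_cos_pow] at hs
  refine Eq.trans (intervalIntegral.integral_congr fun θ _ => ?_) (hs.symm.trans ?_)
  · simp only [inner_eq_coords, sphVec_zero, sphVec_one, sphVec_two, cos_sub]
    congr 1
    linear_combination (-sin φ * cos θ) * h0 - sin φ * sin θ * h1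
  · rw [zonalMean, mul_pow, mul_pow, hq, cos_sq']
    refine Finset.sum_congr rfl fun k _ => ?_
    rw [mul_pow, mul_pow]
    ring

lemma integral_surf_zonal {Ψ : ℝ → ℝ} (hΨ : Continuous Ψ) (m : ℕ) (y z : S2) :
    ∫ n : S2, inner ℝ (n : R3) z ^ (2 * m) * Ψ (√(1 - inner ℝ (n : R3) y ^ 2)) ∂surf =
      ∫ φ in (0:ℝ)..π, sin φ *
        (Ψ (sin φ) * zonalMean m (inner ℝ (y : R3) z ^ 2) (sin φ ^ 2)) := by
  obtain ⟨α, -, β, -, h⟩ := exists_sphVec_eq y (norm_eq_of_mem_sphere y)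
  rw [← integral_surf_comp_isometry (rotIso α β)
    (fun n => inner ℝ (n : R3) z ^ (2 * m) * Ψ (√(1 - inner ℝ (n : R3) y ^ 2)))]
  set w := (rotIso α β).symm z with hw
  have hz : (z : R3) = rotIso α β w := by simp [hw]
  have hy : ∀ x : R3, inner ℝ (y : R3) (rotIso α β x) = x 2 := fun x => by
    rw [← h, rotIso_apply, inner_sphVec_rotUV]
  have hy' : ∀ x : R3, inner ℝ (rotIso α β x) (y : R3) = x 2 := fun x => by
    rw [real_inner_comm, hy]
  simp only [hz, hy, hy', LinearIsometryEquiv.inner_map_map]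
  rw [integral_surf (F := fun x => inner ℝ x w ^ (2 * m) * Ψ (√(1 - x 2 ^ 2))) (by fun_prop)]
  refine intervalIntegral.integral_congr fun φ hφ => ?_
  rw [uIcc_of_le pi_pos.le] at hφ
  have hwn : ‖w‖ = 1 := by rw [hw, LinearIsometryEquiv.norm_map, norm_eq_of_mem_sphere]
  simp only [sphVec_two, sqrt_one_sub_cos_sq hφ, intervalIntegral.integral_mul_const]
  rw [integral_sphVec_pairing_pow w hwn]
  ring

lemma cylVec_cos (θ : ℝ) {φ : ℝ} (hφ : φ ∈ Icc 0 π) :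
    cylVec (cos φ) (√(1 - cos φ ^ 2)) θ = sphVec θ φ := by
  rw [sqrt_one_sub_cos_sq hφ, ← one_smul ℝ (sphVec θ φ), ← cylVec_polar, one_mul, one_mul]

lemma continuous_integral_cylVec {F : R3 → ℝ} (hF : Continuous F) :
    Continuous fun s : ℝ => ∫ θ in (0:ℝ)..(2 * π), F (cylVec s (√(1 - s ^ 2)) θ) := by
  refine intervalIntegral.continuous_parametric_intervalIntegral_of_continuous'
    (f := fun s θ => F (cylVec s (√(1 - s ^ 2)) θ)) ?_ _ _
  exact hF.comp (continuous_cylVec.comp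
    (by fun_prop : Continuous fun p : ℝ × ℝ => (p.1, √(1 - p.1 ^ 2), p.2)))

lemma integral_surf_cyl {F : R3 → ℝ} (hF : Continuous F) :
    ∫ y : S2, F y ∂surf = ∫ s in (0:ℝ)..1,
      ((∫ θ in (0:ℝ)..(2 * π), F (cylVec s (√(1 - s ^ 2)) θ)) +
        ∫ θ in (0:ℝ)..(2 * π), F (cylVec (-s) (√(1 - s ^ 2)) θ)) := by
  set Γ : ℝ → ℝ := fun s => ∫ θ in (0:ℝ)..(2 * π), F (cylVec s (√(1 - s ^ 2)) θ) with hΓ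
  have hΓc : Continuous Γ := continuous_integral_cylVec hF
  have h1 : ∫ y : S2, F y ∂surf = ∫ s in (-1:ℝ)..1, Γ s := by
    have h := intervalIntegral.integral_comp_mul_deriv (a := 0) (b := π) (g := Γ)
      (fun φ _ => hasDerivAt_cos φ) (by fun_prop) hΓc
    rw [cos_zero, cos_pi, intervalIntegral.integral_symm (-1) 1] at h
    rw [integral_surf hF, ← neg_inj, ← h, ← intervalIntegral.integral_neg]
    refine intervalIntegral.integral_congr fun φ hφ => ?_
    rw [uIcc_of_le pi_pos.le] at hφ
    simp only [hΓ, Function.comp_apply, cylVec_cos _ hφ]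
    ring
  have h2 := intervalIntegral.integral_comp_neg (a := 0) (b := 1) Γ
  rw [neg_zero] at h2
  rw [h1, ← intervalIntegral.integral_add_adjacent_intervals (b := 0)
    (hΓc.intervalIntegrable _ _) (hΓc.intervalIntegrable _ _), ← h2, add_comm,
    ← intervalIntegral.integral_add (hΓc.intervalIntegrable _ _)
      ((by fun_prop : Continuous fun s => Γ (-s)).intervalIntegrable _ _)]
  simp only [hΓ, neg_sq]

lemma add_neg_eq_zero_of_moments {g : R3 → ℝ} (hg : Continuous g) (z : S2)
    (h : ∀ m : ℕ, ∫ y : S2, inner ℝ (y : R3) z ^ (2 * m) * g y ∂surf = 0) :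
    g z + g (-z) = 0 := by
  obtain ⟨α, -, β, -, hz⟩ := exists_sphVec_eq z (norm_eq_of_mem_sphere z)
  set L := rotIso α β with hL
  have hin : ∀ x : R3, inner ℝ (L x) (z : R3) = x 2 := fun x => by
    rw [← hz, real_inner_comm, hL, rotIso_apply, inner_sphVec_rotUV]
  have hgL : Continuous fun x => g (L x) := hg.comp L.continuous
  set Γ : ℝ → ℝ := fun s => ∫ θ in (0:ℝ)..(2 * π), g (L (cylVec s (√(1 - s ^ 2)) θ)) with hΓ
  have hΓc : Continuous Γ := continuous_integral_cylVec hgL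
  have hmom : ∀ m : ℕ, ∫ s in Icc (0:ℝ) 1, (s ^ 2) ^ m • (Γ s + Γ (-s)) = 0 := fun m => by
    have := h m
    rw [← integral_surf_comp_isometry L (fun y => inner ℝ (y : R3) z ^ (2 * m) * g y)] at this
    simp only [hin] at this
    rw [integral_surf_cyl (F := fun x => x 2 ^ (2 * m) * g (L x)) (by fun_prop)] at this
    rw [integral_Icc_eq_integral_Ioc, ← intervalIntegral.integral_of_le zero_le_one]
    refine (intervalIntegral.integral_congr fun s _ => ?_).trans this
    have h2 : ∀ s q θ : ℝ, cylVec s q θ 2 = s := fun _ _ _ => rfl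
    simp only [h2, intervalIntegral.integral_const_mul, hΓ, smul_eq_mul, neg_sq, pow_mul]
    ring
  have hpeak := tendsto_setIntegral_pow_smul_of_unique_maximum_of_isCompact_of_continuousOn
    (μ := volume) (s := Icc (0:ℝ) 1) (x₀ := 1) (c := fun s => s ^ 2)
    (g := fun s => Γ s + Γ (-s)) isCompact_Icc (by fun_prop)
    (fun y hy hne => by
      have : y < 1 := lt_of_le_of_ne hy.2 hne
      nlinarith [hy.1])
    (fun x _ => sq_nonneg x) (by norm_num)
    (by rw [interior_Icc, closure_Ioo zero_ne_one]; exact ⟨zero_le_one, le_rfl⟩)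
    (by fun_prop)
  simp only [hmom, smul_zero] at hpeak
  have h0 := tendsto_nhds_unique hpeak tendsto_const_nhds
  have hpole : ∀ θ, cylVec 1 0 θ = sphVec 0 0 := fun θ => by
    ext i; fin_cases i <;> simp [cylVec]
  have hpole' : ∀ θ, cylVec (-1) 0 θ = -sphVec 0 0 := fun θ => by
    ext i; fin_cases i <;> simp [cylVec]
  have hLz : L (sphVec 0 0) = z := by
    rw [← hz]
    ext i
    fin_cases i <;> simp [hL, rotUV, rotZ, rotY, mul_comm]
  simp only [hΓ, neg_sq, one_pow, sub_self, sqrt_zero, hpole, hpole', map_neg, hLz,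
    intervalIntegral.integral_const, smul_eq_mul, sub_zero] at h0
  have := two_pi_pos
  nlinarith

lemma continuous_eq_zero_on_Icc {e : ℝ → ℝ} (he : Continuous e) {a b : ℝ} (hab : a < b)
    (h : ∀ t ∈ Ioo a b, e t = 0) : ∀ t ∈ Icc a b, e t = 0 := by
  rw [← closure_Ioo hab.ne]
  exact closure_minimal h (isClosed_eq he continuous_const)

lemma eq_zero_of_volterra {e : ℝ → ℝ} (he : Continuous e) (K : Polynomial ℝ) (hK : K.eval 1 ≠ 0)
    {t₁ δ : ℝ} (ht₁ : 0 < t₁) (h0 : ∀ t ∈ Icc 0 t₁, e t = 0)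
    (h : ∀ R ∈ Ioc 0 δ, ∫ v in (0:ℝ)..R, e v * K.eval ((v / R) ^ 2) = 0) :
    ∀ t ∈ Icc 0 δ, e t = 0 := by
  intro t ht
  rcases le_or_gt t t₁ with htt | htt
  · exact h0 t ⟨ht.1, htt⟩
  have hδ : t₁ < δ := htt.trans_le ht.2
  set N := K.natDegree
  set E : ℕ → ℝ → ℝ := fun i R => ∫ v in (0:ℝ)..R, e v * v ^ (2 * i) with hE
  have hEd : ∀ i R, HasDerivAt (E i) (e R * R ^ (2 * i)) R := fun i R =>
    intervalIntegral.integral_hasDerivAt_right ((by fun_prop : Continuous _).intervalIntegrable _ _)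
      (by fun_prop : Continuous _).stronglyMeasurable.stronglyMeasurableAtFilter
      (by fun_prop : Continuous _).continuousAt
  set u : ℝ → ℝ := fun R => ∫ v in (0:ℝ)..R, |e v| with hu
  have hud : ∀ R, HasDerivAt u |e R| R := fun R =>
    intervalIntegral.integral_hasDerivAt_right ((by fun_prop : Continuous _).intervalIntegrable _ _)
      (by fun_prop : Continuous _).stronglyMeasurable.stronglyMeasurableAtFilter
      (by fun_prop : Continuous _).continuousAt
  have hEu : ∀ i, ∀ R ∈ Icc 0 δ, |E i R| ≤ δ ^ (2 * i) * u R := fun i R hR => by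
    rw [hu, ← intervalIntegral.integral_const_mul]
    refine (intervalIntegral.abs_integral_le_integral_abs hR.1).trans ?_
    refine intervalIntegral.integral_mono_on hR.1
      ((by fun_prop : Continuous _).intervalIntegrable _ _)
      ((by fun_prop : Continuous _).intervalIntegrable _ _) fun v hv => ?_
    rw [abs_mul, abs_of_nonneg (pow_nonneg hv.1 _), mul_comm]
    gcongr
    · exact hv.1
    · exact hv.2.trans hR.2
  set S : ℝ → ℝ := fun R =>
    ∑ i ∈ Finset.range (N + 1), K.coeff i * (R ^ (2 * (N - i)) * E i R) with hS
  have hS0 : ∀ R ∈ Ioo 0 δ, S R = 0 := fun R hR => by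
    have h1 := h R ⟨hR.1, hR.2.le⟩
    have h2 : S R = R ^ (2 * N) * ∫ v in (0:ℝ)..R, e v * K.eval ((v / R) ^ 2) := by
      simp only [hS, hE, ← intervalIntegral.integral_const_mul]
      rw [← intervalIntegral.integral_finsetSum
        fun i _ => (by fun_prop : Continuous _).intervalIntegrable _ _]
      refine intervalIntegral.integral_congr fun v _ => ?_
      rw [Polynomial.eval_eq_sum_range, Finset.mul_sum, Finset.mul_sum]
      refine Finset.sum_congr rfl fun i hi => ?_
      have hiN : i ≤ N := Nat.lt_succ_iff.1 (Finset.mem_range.1 hi)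
      have hRN : R ^ (2 * N) = R ^ (2 * (N - i)) * R ^ (2 * i) := by
        rw [← pow_add, ← mul_add, Nat.sub_add_cancel hiN]
      have : R ≠ 0 := hR.1.ne'
      rw [hRN, div_pow, div_pow, ← pow_mul, ← pow_mul]
      field_simp
    rw [h2, h1, mul_zero]
  have hSd : ∀ R, HasDerivAt S (∑ i ∈ Finset.range (N + 1), K.coeff i *
      (((2 * (N - i) : ℕ) : ℝ) * R ^ (2 * (N - i) - 1) * E i R +
        R ^ (2 * (N - i)) * (e R * R ^ (2 * i)))) R := fun R =>
    HasDerivAt.fun_sum fun i _ => ((hasDerivAt_pow _ R).mul (hEd i R)).const_mul _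
  set B : ℝ := ∑ i ∈ Finset.range (N + 1), |K.coeff i| *
      (((2 * (N - i) : ℕ) : ℝ) * δ ^ (2 * (N - i) - 1) * δ ^ (2 * i)) with hB
  have hbound : ∀ R ∈ Ioo 0 δ, R ^ (2 * N) * |K.eval 1| * |e R| ≤ B * u R := fun R hR => by
    have hz := (hSd R).unique ((hasDerivAt_const R (0:ℝ)).congr_of_eventuallyEq
      (Filter.eventuallyEq_of_mem (Ioo_mem_nhds hR.1 hR.2) hS0))
    have hsplit : R ^ (2 * N) * K.eval 1 * e R = -∑ i ∈ Finset.range (N + 1), K.coeff i *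
        (((2 * (N - i) : ℕ) : ℝ) * R ^ (2 * (N - i) - 1) * E i R) := by
      rw [eq_neg_iff_add_eq_zero, ← hz, Polynomial.eval_eq_sum_range, Finset.mul_sum,
        Finset.sum_mul, ← Finset.sum_add_distrib]
      refine Finset.sum_congr rfl fun i hi => ?_
      have hiN : i ≤ N := Nat.lt_succ_iff.1 (Finset.mem_range.1 hi)
      have hRN : R ^ (2 * N) = R ^ (2 * (N - i)) * R ^ (2 * i) := by
        rw [← pow_add, ← mul_add, Nat.sub_add_cancel hiN]
      rw [hRN, one_pow]
      ring
    have habs : R ^ (2 * N) * |K.eval 1| * |e R| = |R ^ (2 * N) * K.eval 1 * e R| := by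
      rw [abs_mul, abs_mul, abs_of_nonneg (pow_nonneg hR.1.le _)]
    rw [habs, hsplit, abs_neg, hB, Finset.sum_mul]
    refine (Finset.abs_sum_le_sum_abs _ _).trans (Finset.sum_le_sum fun i _ => ?_)
    rw [abs_mul, abs_mul, abs_of_nonneg (mul_nonneg (Nat.cast_nonneg _) (pow_nonneg hR.1.le _)),
      mul_assoc |K.coeff i|, mul_assoc _ _ (u R)]
    have := hR.1.le
    have := ht₁.le.trans hδ.le
    gcongr
    · exact hR.2.le
    · exact hEu i R ⟨hR.1.le, hR.2.le⟩
  have hc : 0 < t₁ ^ (2 * N) * |K.eval 1| := by positivity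
  have hbound' : ∀ R ∈ Ico t₁ δ, |e R| ≤ B / (t₁ ^ (2 * N) * |K.eval 1|) * u R := fun R hR => by
    rw [div_mul_eq_mul_div, le_div_iff₀ hc, mul_comm]
    refine le_trans ?_ (hbound R ⟨ht₁.trans_le hR.1, hR.2⟩)
    gcongr
    exact hR.1
  have hut : u t₁ = 0 := by
    rw [hu]
    refine intervalIntegral.integral_zero_ae (Filter.Eventually.of_forall fun v hv => ?_)
    rw [uIoc_of_le ht₁.le] at hv
    rw [h0 v (Ioc_subset_Icc_self hv), abs_zero]
  have hu0 := eq_zero_of_abs_deriv_le_mul_abs_self_of_eq_zero_right (f := u) (f' := fun R => |e R|)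
    (K := B / (t₁ ^ (2 * N) * |K.eval 1|)) (a := t₁) (b := δ)
    (fun R _ => (hud R).continuousAt.continuousWithinAt) (fun R _ => (hud R).hasDerivWithinAt) hut
    (fun R hR => by
      have hun : 0 ≤ u R :=
        intervalIntegral.integral_nonneg (ht₁.le.trans hR.1) fun _ _ => abs_nonneg _
      rw [Real.norm_eq_abs, abs_abs, Real.norm_of_nonneg hun]
      exact hbound' R hR)
  refine continuous_eq_zero_on_Icc he hδ (fun R hR => ?_) t ⟨htt.le, ht.2⟩
  have := hbound' R ⟨hR.1.le, hR.2⟩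
  rw [hu0 R ⟨hR.1.le, hR.2.le⟩, mul_zero] at this
  exact abs_nonpos_iff.1 this

lemma integral_comp_abs_sin {H : ℝ → ℝ} (hH : Continuous H) :
    ∫ θ in (0:ℝ)..(2 * π), H |sin θ| = 2 * ∫ θ in (0:ℝ)..π, H (sin θ) := by
  have hc : Continuous fun θ => H |sin θ| := by fun_prop
  have h1 : ∫ θ in (0:ℝ)..π, H |sin θ| = ∫ θ in (0:ℝ)..π, H (sin θ) := by
    refine intervalIntegral.integral_congr fun θ hθ => ?_
    rw [uIcc_of_le pi_pos.le] at hθ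
    simp only [abs_of_nonneg (sin_nonneg_of_nonneg_of_le_pi hθ.1 hθ.2)]
  have h2 := intervalIntegral.integral_comp_add_right (a := 0) (b := π) (fun θ => H |sin θ|) π
  simp only [sin_add_pi, abs_neg, zero_add, ← two_mul] at h2
  rw [← intervalIntegral.integral_add_adjacent_intervals (b := π)
    (hc.intervalIntegrable _ _) (hc.intervalIntegrable _ _), ← h2, h1, two_mul]

/-- The polynomial `u ↦ ∑ⱼ cⱼ uʲ ∫ (1 - (1 - u) cos² θ) ^ (deg p - j) dθ`, where `p = ∑ⱼ cⱼ Xʲ`. -/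
def latKernel (p : Polynomial ℝ) : Polynomial ℝ :=
  ∑ j ∈ Finset.range (p.natDegree + 1), Polynomial.C (p.coeff j) * Polynomial.X ^ j *
    ∑ i ∈ Finset.range (p.natDegree - j + 1),
      Polynomial.C ((-1) ^ i * (p.natDegree - j).choose i * cosMoment (2 * i)) *
        (1 - Polynomial.X) ^ i

lemma eval_latKernel (p : Polynomial ℝ) (u : ℝ) :
    (latKernel p).eval u = ∑ j ∈ Finset.range (p.natDegree + 1), p.coeff j * u ^ j *
      ∫ θ in (0:ℝ)..(2 * π), (1 - (1 - u) * cos θ ^ 2) ^ (p.natDegree - j) := by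
  simp only [latKernel, Polynomial.eval_finsetSum, Polynomial.eval_mul, Polynomial.eval_C,
    Polynomial.eval_pow, Polynomial.eval_X, Polynomial.eval_sub, Polynomial.eval_one]
  refine Finset.sum_congr rfl fun j _ => ?_
  congr 1
  have hbin : ∀ θ, (1 - (1 - u) * cos θ ^ 2) ^ (p.natDegree - j) =
      ∑ i ∈ Finset.range (p.natDegree - j + 1),
        (-1) ^ i * (p.natDegree - j).choose i * (1 - u) ^ i * cos θ ^ (2 * i) := fun θ => by
    rw [sub_eq_neg_add, add_pow]
    refine Finset.sum_congr rfl fun i _ => ?_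
    rw [one_pow, neg_pow, mul_pow, ← pow_mul]
    ring
  simp_rw [hbin]
  rw [intervalIntegral.integral_finsetSum
    fun i _ => (by fun_prop : Continuous _).intervalIntegrable _ _]
  refine Finset.sum_congr rfl fun i _ => ?_
  rw [intervalIntegral.integral_const_mul, ← cosMoment]
  ring

lemma eval_one_latKernel (p : Polynomial ℝ) : (latKernel p).eval 1 = 2 * π * p.eval 1 := by
  rw [eval_latKernel, Polynomial.eval_eq_sum_range, Finset.mul_sum]
  refine Finset.sum_congr rfl fun j _ => ?_
  simp [mul_comm]

lemma integral_mul_latKernel_eq_zero {b : ℝ → ℝ} (hb : Continuous b) (p : Polynomial ℝ) {R : ℝ}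
    (hR : 0 ≤ R) (h : ∀ r ∈ Icc 0 R,
      ∫ φ in (0:ℝ)..π, sin φ * (b (r * sin φ) * p.eval (sin φ ^ 2)) = 0) :
    ∫ s in (0:ℝ)..1, s * b (R * s) * (latKernel p).eval (s ^ 2) = 0 := by
  set M := p.natDegree with hM
  set F : R3 → ℝ := fun x => b (R * |x 1|) * |x 1| *
    ∑ j ∈ Finset.range (M + 1), p.coeff j * (x 1 ^ 2) ^ j * (1 - x 2 ^ 2) ^ (M - j) with hF
  have hFc : Continuous F := by fun_prop
  have hF0 : ∫ y : S2, F y ∂surf = 0 := by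
    rw [integral_surf hFc]
    refine intervalIntegral.integral_zero_ae (Filter.Eventually.of_forall fun φ hφ => ?_)
    rw [uIoc_of_le pi_pos.le] at hφ
    have hs : 0 ≤ sin φ := sin_nonneg_of_nonneg_of_le_pi hφ.1.le hφ.2
    have hFs : ∀ θ, F (sphVec θ φ) = sin φ ^ (2 * M + 1) *
        (|sin θ| * (b (R * sin φ * |sin θ|) * p.eval (|sin θ| ^ 2))) := fun θ => by
      have hsum : ∑ j ∈ Finset.range (M + 1),
          p.coeff j * ((sin φ * sin θ) ^ 2) ^ j * (1 - cos φ ^ 2) ^ (M - j) =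
            sin φ ^ (2 * M) * p.eval (|sin θ| ^ 2) := by
        rw [Polynomial.eval_eq_sum_range, Finset.mul_sum]
        refine Finset.sum_congr rfl fun j hj => ?_
        have hjM : j ≤ M := Nat.lt_succ_iff.1 (Finset.mem_range.1 hj)
        rw [← sin_sq, sq_abs, mul_pow, mul_pow, pow_mul (sin φ) 2 M,
          ← Nat.add_sub_cancel' hjM, pow_add, Nat.add_sub_cancel_left]
        ring
      simp only [hF, sphVec_one, sphVec_two, hsum, abs_mul, abs_of_nonneg hs]
      ring_nf
    simp only [hFs, intervalIntegral.integral_const_mul]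
    rw [integral_comp_abs_sin (H := fun s => s * (b (R * sin φ * s) * p.eval (s ^ 2)))
      (by fun_prop), h _ ⟨by positivity, mul_le_of_le_one_right hR (sin_le_one φ)⟩]
    ring
  set L := rotIso (π / 2) (π / 2) with hL
  have hL1 : ∀ x : R3, L x 1 = x 2 := fun x => by simp [hL, rotUV, rotZ, rotY]
  have hL2 : ∀ x : R3, L x 2 = -x 0 := fun x => by simp [hL, rotUV, rotZ, rotY]
  have hcyl : ∀ s ∈ Icc (0:ℝ) 1, ∀ σ : ℝ, |σ| = s →
      ∫ θ in (0:ℝ)..(2 * π), F (L (cylVec σ (√(1 - s ^ 2)) θ)) =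
        s * b (R * s) * (latKernel p).eval (s ^ 2) := fun s hs σ hσ => by
    have hσ2 : σ ^ 2 = s ^ 2 := by rw [← hσ, sq_abs]
    have hq : √(1 - s ^ 2) ^ 2 = 1 - s ^ 2 := sq_sqrt (by nlinarith [hs.1, hs.2])
    have hc0 : ∀ z q θ : ℝ, cylVec z q θ 0 = q * cos θ := fun _ _ _ => rfl
    have hc2 : ∀ z q θ : ℝ, cylVec z q θ 2 = z := fun _ _ _ => rfl
    simp only [hF, hL1, hL2, hc0, hc2, hσ, hσ2, neg_sq, mul_pow, hq,
      intervalIntegral.integral_const_mul]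
    rw [intervalIntegral.integral_finsetSum
      fun i _ => (by fun_prop : Continuous _).intervalIntegrable _ _, eval_latKernel]
    simp only [intervalIntegral.integral_const_mul]
    rw [mul_comm s]
  rw [← integral_surf_comp_isometry L (fun y => F y),
    integral_surf_cyl (F := fun x => F (L x)) (hFc.comp L.continuous)] at hF0
  rw [intervalIntegral.integral_congr
    (g := fun s => 2 * (s * b (R * s) * (latKernel p).eval (s ^ 2))) fun s hs => ?_,
    intervalIntegral.integral_const_mul] at hF0
  · linarith
  · rw [uIcc_of_le zero_le_one] at hs
    simp only
    rw [hcyl s hs s (abs_of_nonneg hs.1), hcyl s hs (-s) (by rw [abs_neg, abs_of_nonneg hs.1]),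
      two_mul]

lemma eq_zero_of_integral_sin {b : ℝ → ℝ} (hb : Continuous b) (p : Polynomial ℝ)
    (hp : p.eval 1 ≠ 0) {t₁ δ : ℝ} (ht₁ : 0 < t₁) (h0 : ∀ t ∈ Icc 0 t₁, b t = 0)
    (h : ∀ r ∈ Icc 0 δ, ∫ φ in (0:ℝ)..π, sin φ * (b (r * sin φ) * p.eval (sin φ ^ 2)) = 0) :
    ∀ t ∈ Icc 0 δ, b t = 0 := by
  have hv := eq_zero_of_volterra (e := fun v => v * b v) (by fun_prop) (latKernel p)
    (by rw [eval_one_latKernel]; positivity) ht₁ (δ := δ)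
    (fun t ht => by rw [h0 t ht, mul_zero]) fun R hR => by
      have h1 := integral_mul_latKernel_eq_zero hb p hR.1.le
        fun r hr => h r ⟨hr.1, hr.2.trans hR.2⟩
      have h2 := intervalIntegral.mul_integral_comp_mul_left (a := 0) (b := 1) (c := R)
        (f := fun v => v * b v * (latKernel p).eval ((v / R) ^ 2))
      rw [mul_zero, mul_one] at h2
      rw [← h2]
      simp only [mul_div_cancel_left₀ _ hR.1.ne', mul_assoc R,
        intervalIntegral.integral_const_mul, h1, mul_zero]
  intro t ht
  rcases ht.1.eq_or_lt with rfl | hpos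
  · exact h0 0 ⟨le_rfl, ht₁.le⟩
  · exact (mul_eq_zero.1 (hv t ht)).resolve_left hpos.ne'

lemma integral_surf_intervalIntegral_swap {F : S2 → ℝ → ℝ} (hF : Continuous F.uncurry) {a b : ℝ}
    (hab : a ≤ b) :
    ∫ y : S2, (∫ φ in a..b, F y φ) ∂surf = ∫ φ in a..b, (∫ y : S2, F y φ ∂surf) := by
  rw [intervalIntegral_integral_swap]
  rw [uIoc_of_le hab, ← Measure.restrict_univ (μ := surf), Measure.prod_restrict]
  exact ((hF.comp continuous_swap).continuousOn.integrableOn_compact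
    (isCompact_Icc.prod isCompact_univ)).mono_set (prod_mono Ioc_subset_Icc_self Subset.rfl)

lemma continuous_integral_surf {X : Type*} [TopologicalSpace X] [FirstCountableTopology X]
    [LocallyCompactSpace X] {F : X → S2 → ℝ} (hF : Continuous F.uncurry) :
    Continuous fun x => ∫ y : S2, F x y ∂surf := by
  have := continuous_parametric_integral_of_continuous (μ := surf) hF isCompact_univ
  simpa only [Measure.restrict_univ] using this

lemma continuous_zonalMean (m : ℕ) : Continuous fun p : ℝ × ℝ => zonalMean m p.1 p.2 := by
  unfold zonalMean
  fun_prop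

lemma integral_zonalMean_eq_zero {G : S2 → ℝ → ℝ} (hG : Continuous G.uncurry) (z : S2) {r : ℝ}
    (h : ∀ n : S2, ∫ y : S2, G y (r * √(1 - inner ℝ (n : R3) y ^ 2)) ∂surf = 0) (m : ℕ) :
    ∫ φ in (0:ℝ)..π, (∫ y : S2, sin φ *
      (G y (r * sin φ) * zonalMean m (inner ℝ (y : R3) z ^ 2) (sin φ ^ 2)) ∂surf) = 0 := by
  have hz := continuous_zonalMean m
  rw [← integral_surf_intervalIntegral_swap (F := fun y φ => sin φ *
      (G y (r * sin φ) * zonalMean m (inner ℝ (y : R3) z ^ 2) (sin φ ^ 2))) ?_ pi_pos.le]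
  · have hzonal : ∀ y : S2, ∫ φ in (0:ℝ)..π, sin φ *
        (G y (r * sin φ) * zonalMean m (inner ℝ (y : R3) z ^ 2) (sin φ ^ 2)) =
          ∫ n : S2, inner ℝ (n : R3) z ^ (2 * m) *
            G y (r * √(1 - inner ℝ (n : R3) y ^ 2)) ∂surf := fun y =>
      (integral_surf_zonal (Ψ := fun s => G y (r * s))
        (hG.comp (by fun_prop : Continuous fun s : ℝ => (y, r * s))) m y z).symm
    simp only [hzonal]
    rw [integral_integral_swap_of_hasCompactSupport ?_ (HasCompactSupport.of_compactSpace _)]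
    · simp only [integral_const_mul, h, mul_zero, integral_zero]
    · exact (by fun_prop : Continuous fun p : S2 × S2 => inner ℝ (p.2 : R3) z ^ (2 * m)).mul
        (hG.comp (by fun_prop : Continuous fun p : S2 × S2 =>
          (p.1, r * √(1 - inner ℝ (p.2 : R3) p.1 ^ 2))))
  · exact (by fun_prop : Continuous fun p : S2 × ℝ => sin p.2).mul
      ((hG.comp (by fun_prop : Continuous fun p : S2 × ℝ => (p.1, r * sin p.2))).mul
        (hz.comp (by fun_prop : Continuous fun p : S2 × ℝ =>
          (inner ℝ (p.1 : R3) z ^ 2, sin p.2 ^ 2))))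

lemma mixed_moment_eq {g : S2 → ℝ} (hg : Continuous g) (z : S2) {m : ℕ}
    (h : ∀ j < m, ∫ y : S2, inner ℝ (y : R3) z ^ (2 * j) * g y ∂surf = 0) {k : ℕ} (hk : k ≤ m) :
    ∫ y : S2, (inner ℝ (y : R3) z ^ 2) ^ (m - k) * (1 - inner ℝ (y : R3) z ^ 2) ^ k * g y ∂surf =
      (-1) ^ k * ∫ y : S2, inner ℝ (y : R3) z ^ (2 * m) * g y ∂surf := by
  have key : ∀ k i : ℕ, i + k ≤ m →
      ∫ y : S2, (inner ℝ (y : R3) z ^ 2) ^ i * (1 - inner ℝ (y : R3) z ^ 2) ^ k * g y ∂surf =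
        if i + k = m then (-1) ^ k * ∫ y : S2, inner ℝ (y : R3) z ^ (2 * m) * g y ∂surf else 0 := by
    intro k
    induction k with
    | zero =>
      intro i hi
      simp only [pow_zero, mul_one, ← pow_mul, one_mul, add_zero]
      split_ifs with him
      · rw [him]
      · exact h i (by omega)
    | succ k ih =>
      intro i hi
      have hsplit : ∀ y : S2,
          (inner ℝ (y : R3) z ^ 2) ^ i * (1 - inner ℝ (y : R3) z ^ 2) ^ (k + 1) * g y =
          (inner ℝ (y : R3) z ^ 2) ^ i * (1 - inner ℝ (y : R3) z ^ 2) ^ k * g y -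
          (inner ℝ (y : R3) z ^ 2) ^ (i + 1) * (1 - inner ℝ (y : R3) z ^ 2) ^ k * g y :=
        fun y => by ring
      simp only [hsplit]
      rw [integral_sub (integrable_surf (by fun_prop)) (integrable_surf (by fun_prop)),
        ih i (by omega), ih (i + 1) (by omega), if_neg (by omega : ¬ i + k = m), zero_sub,
        show i + 1 + k = i + (k + 1) by ring]
      split_ifs
      · ring
      · ring
  rw [key k (m - k) (by omega), if_pos (by omega)]

lemma moment_eq_zero {G : S2 → ℝ → ℝ} (hG : Continuous G.uncurry) (z : S2) {t₁ δ : ℝ}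
    (ht₁ : 0 < t₁) (h0 : ∀ y, ∀ t ∈ Icc 0 t₁, G y t = 0)
    (h : ∀ r ∈ Icc 0 δ, ∀ n : S2,
      ∫ y : S2, G y (r * √(1 - inner ℝ (n : R3) y ^ 2)) ∂surf = 0) (m : ℕ) :
    ∀ t ∈ Icc 0 δ, ∫ y : S2, inner ℝ (y : R3) z ^ (2 * m) * G y t ∂surf = 0 := by
  induction m using Nat.strong_induction_on with
  | _ m ih =>
  set b : ℝ → ℝ := fun t => ∫ y : S2, inner ℝ (y : R3) z ^ (2 * m) * G y t ∂surf with hb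
  have hGt : ∀ t, Continuous fun y => G y t := fun t =>
    hG.comp (by fun_prop : Continuous fun y : S2 => (y, t))
  have hbc : Continuous b := continuous_integral_surf
    ((by fun_prop : Continuous fun p : ℝ × S2 => inner ℝ (p.2 : R3) z ^ (2 * m)).mul
      (hG.comp continuous_swap))
  set p : Polynomial ℝ := ∑ k ∈ Finset.range (m + 1),
    Polynomial.C ((2 * m).choose (2 * k) * cosMoment (2 * k) * (-1) ^ k) *
      ((1 - Polynomial.X) ^ (m - k) * Polynomial.X ^ k) with hp
  have hpe : ∀ u, p.eval u = ∑ k ∈ Finset.range (m + 1),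
      (2 * m).choose (2 * k) * cosMoment (2 * k) * (-1) ^ k * ((1 - u) ^ (m - k) * u ^ k) :=
    fun u => by simp [hp, Polynomial.eval_finsetSum]
  have hp1 : p.eval 1 ≠ 0 := by
    rw [hpe, Finset.sum_eq_single m]
    · have := cosMoment_even_pos m
      simp [this.ne']
    · intro k hk hkm
      have hk' := Finset.mem_range.1 hk
      rw [sub_self, zero_pow (by omega)]
      ring
    · intro hm
      exact absurd (Finset.mem_range.2 m.lt_succ_self) hm
  refine eq_zero_of_integral_sin hbc p hp1 ht₁ (fun t ht => ?_) fun r hr => ?_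
  · simp only [hb, h0 _ t ht, mul_zero, integral_zero]
  · refine Eq.trans ?_ (integral_zonalMean_eq_zero hG z (h r hr) m)
    refine intervalIntegral.integral_congr fun φ hφ => ?_
    rw [uIcc_of_le pi_pos.le] at hφ
    have hs : 0 ≤ sin φ := sin_nonneg_of_nonneg_of_le_pi hφ.1 hφ.2
    have hrφ : r * sin φ ∈ Icc 0 δ := ⟨mul_nonneg hr.1 hs,
      (mul_le_of_le_one_right hr.1 (sin_le_one φ)).trans hr.2⟩
    have hc := hGt (r * sin φ)
    simp only [integral_const_mul]
    congr 1
    have hexp : ∀ y : S2, G y (r * sin φ) * zonalMean m (inner ℝ (y : R3) z ^ 2) (sin φ ^ 2) =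
        ∑ k ∈ Finset.range (m + 1), ((2 * m).choose (2 * k) * cosMoment (2 * k) *
          ((1 - sin φ ^ 2) ^ (m - k) * (sin φ ^ 2) ^ k)) *
          ((inner ℝ (y : R3) z ^ 2) ^ (m - k) * (1 - inner ℝ (y : R3) z ^ 2) ^ k *
            G y (r * sin φ)) := fun y => by
      rw [zonalMean, Finset.mul_sum]
      exact Finset.sum_congr rfl fun k _ => by ring
    simp only [hexp]
    rw [integral_finsetSum _ fun k _ => integrable_surf (by fun_prop), hpe, Finset.mul_sum]
    refine Finset.sum_congr rfl fun k hk => ?_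
    rw [integral_const_mul, mixed_moment_eq hc z (fun j hj => ih j hj _ hrφ)
      (Nat.lt_succ_iff.1 (Finset.mem_range.1 hk))]
    ring

lemma eq_zero_of_integral_sq_mul_eq_zero {g : ℝ → ℝ} (hg : Continuous g) {ε : ℝ} (hε : 1 < ε)
    (h : ∀ R ∈ Icc 1 ε, ∫ ρ in (1:ℝ)..R, ρ ^ 2 * g ρ = 0) : ∀ R ∈ Icc 1 ε, g R = 0 := by
  refine continuous_eq_zero_on_Icc hg hε fun R hR => ?_
  have hd : HasDerivAt (fun R => ∫ ρ in (1:ℝ)..R, ρ ^ 2 * g ρ) (R ^ 2 * g R) R :=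
    intervalIntegral.integral_hasDerivAt_right ((by fun_prop : Continuous _).intervalIntegrable _ _)
      (by fun_prop : Continuous _).stronglyMeasurable.stronglyMeasurableAtFilter
      (by fun_prop : Continuous _).continuousAt
  have hz := hd.unique ((hasDerivAt_const R (0:ℝ)).congr_of_eventuallyEq
    (Filter.eventuallyEq_of_mem (Icc_mem_nhds hR.1 hR.2) h))
  exact (mul_eq_zero.1 hz).resolve_left (pow_ne_zero 2 (by linarith [hR.1]))

lemma sqrt_add_self_of_half_sub_inv {R : ℝ} (hR : 0 < R) :
    √(((R ^ 2 - 1) / (2 * R)) ^ 2 + 1) + (R ^ 2 - 1) / (2 * R) = R := by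
  rw [show ((R ^ 2 - 1) / (2 * R)) ^ 2 + 1 = ((R ^ 2 + 1) / (2 * R)) ^ 2 by field_simp; ring,
    sqrt_sq (by positivity)]
  field_simp
  ring

lemma half_sub_inv_mono {R S : ℝ} (hR : 0 < R) (hRS : R ≤ S) :
    (R ^ 2 - 1) / (2 * R) ≤ (S ^ 2 - 1) / (2 * S) := by
  have hS := hR.trans_le hRS
  rw [div_le_div_iff₀ (by positivity) (by positivity)]
  nlinarith [mul_nonneg (sub_nonneg.2 hRS) (by positivity : 0 ≤ R * S + 1)]

lemma sqrt_add_self_mono {s t : ℝ} (hs : 0 ≤ s) (hst : s ≤ t) :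
    √(s ^ 2 + 1) + s ≤ √(t ^ 2 + 1) + t := by
  gcongr

lemma one_le_sqrt_add_self {t : ℝ} (ht : 0 ≤ t) : 1 ≤ √(t ^ 2 + 1) + t := by
  simpa using sqrt_add_self_mono le_rfl ht

/-- Theorem 6 of the paper: the apple interior transform on `0 ≤ r ≤ δ`
determines a smooth function supported in `B_{ε₁,ε₂} ∩ U` (exterior to the unit ball)
uniquely for `1 ≤ |x| ≤ ε`. -/
theorem apple_interior_transform_determines
    (ε₁ ε₂ : ℝ) (hε₁ : 1 < ε₁) (h₁₂ : ε₁ < ε₂)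
    (f : R3 → ℝ) (hf : ContDiff ℝ (⊤ : ℕ∞) f) (hfc : HasCompactSupport f)
    (hsupp : tsupport f ⊆ hollowBall ε₁ ε₂ ∩ upperHalf)
    (ε : ℝ) (hε : ε₁ ≤ ε ∧ ε ≤ ε₂) (δ : ℝ) (hδ : δ = (ε ^ 2 - 1) / (2 * ε))
    (hAI : ∀ r ∈ Icc (0:ℝ) δ, ∀ α ∈ Icc (0:ℝ) (2 * π), ∀ β ∈ Icc (0:ℝ) π,
      appleIntT f r α β = 0) :
    ∀ x : R3, 1 ≤ ‖x‖ → ‖x‖ ≤ ε → f x = 0 := by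
  have hfc' := hf.continuous
  have hf0 : ∀ x : R3, ¬ (ε₁ < ‖x‖ ∧ 0 < x 2) → f x = 0 := fun x hx => by
    by_contra hne
    have := hsupp (subset_tsupport f hne)
    exact hx ⟨this.1.1, this.2⟩
  have hε1 : 1 < ε := hε₁.trans_le hε.1
  have hR := continuous_radialInt hfc'
  have hneg : ∀ x : R3, (-x) 2 = -x 2 := fun _ => rfl
  set t₁ := (ε₁ ^ 2 - 1) / (2 * ε₁) with ht₁
  have hpos₁ : 0 < ε₁ := zero_lt_one.trans hε₁
  have ht₁pos : 0 < t₁ := div_pos (by nlinarith) (by positivity)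
  have hzero : ∀ y : S2, ∀ t ∈ Icc 0 t₁, radialInt f y t = 0 := fun y t ht => by
    have hle : √(t ^ 2 + 1) + t ≤ ε₁ :=
      (sqrt_add_self_mono ht.1 ht.2).trans_eq (sqrt_add_self_of_half_sub_inv hpos₁)
    refine intervalIntegral.integral_zero_ae (Filter.Eventually.of_forall fun ρ hρ => ?_)
    rw [uIoc_of_le (one_le_sqrt_add_self ht.1)] at hρ
    rw [hf0, mul_zero]
    rw [norm_smul, norm_eq_of_mem_sphere, mul_one, Real.norm_of_nonneg (zero_le_one.trans hρ.1.le)]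
    exact fun hlt => absurd hlt.1 (hρ.2.trans hle).not_gt
  have hmean : ∀ r ∈ Icc 0 δ, ∀ n : S2,
      ∫ y : S2, radialInt f y (r * √(1 - inner ℝ (n : R3) y ^ 2)) ∂surf = 0 := fun r hr n => by
    obtain ⟨α, hα, β, hβ, hn⟩ := exists_sphVec_eq n (norm_eq_of_mem_sphere n)
    rw [← hn, ← appleIntT_eq_integral_surf hfc', hAI r hr α hα β hβ]
  have hrad : ∀ z : S2, 0 < (z : R3) 2 → ∀ t ∈ Icc 0 δ, radialInt f z t = 0 := fun z hz t ht => by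
    have hodd := add_neg_eq_zero_of_moments (g := fun x => radialInt f x t)
      (hR.comp (by fun_prop : Continuous fun x : R3 => (x, t))) z fun m =>
      moment_eq_zero (G := fun y t => radialInt f y t)
        (hR.comp (by fun_prop : Continuous fun p : S2 × ℝ => ((p.1 : R3), p.2))) z ht₁pos hzero
        hmean m t ht
    have hopp : radialInt f (-z) t = 0 := by
      refine intervalIntegral.integral_zero_ae (Filter.Eventually.of_forall fun ρ hρ => ?_)
      rw [uIoc_of_le (one_le_sqrt_add_self ht.1)] at hρ
      rw [hf0, mul_zero]
      rw [smul_neg, hneg, PiLp.smul_apply, smul_eq_mul]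
      have := mul_pos (zero_lt_one.trans hρ.1) hz
      exact fun hlt => by linarith [hlt.2]
    simpa only [hopp, add_zero] using hodd
  intro x hx1 hxε
  by_cases hx2 : 0 < x 2
  · have hxn : 0 < ‖x‖ := zero_lt_one.trans_le hx1
    have hmem : ‖x‖⁻¹ • x ∈ S2 := by
      rw [S2, mem_sphere_zero_iff_norm, norm_smul, norm_inv, norm_norm, inv_mul_cancel₀ hxn.ne']
    have hz := hrad ⟨_, hmem⟩ (mul_pos (inv_pos.2 hxn) hx2)
    have hline := eq_zero_of_integral_sq_mul_eq_zero (g := fun R => f (R • ‖x‖⁻¹ • x))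
      (by fun_prop) hε1 (fun R hR => by
        have hR0 : 0 < R := zero_lt_one.trans_le hR.1
        have := hz ((R ^ 2 - 1) / (2 * R)) ⟨div_nonneg (by nlinarith [hR.1]) (by positivity), by
          rw [hδ]; exact half_sub_inv_mono hR0 hR.2⟩
        rwa [radialInt, sqrt_add_self_of_half_sub_inv hR0] at this) ‖x‖ ⟨hx1, hxε⟩
    simpa only [smul_smul, mul_inv_cancel₀ hxn.ne', one_smul] using hline
  · exact hf0 x fun h => hx2 h.2
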